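/- Under the standing assumptions, the following localized gradient bound holds at every (x,t) ∈ U × [0,T] with ψ(x,t) > 0: if α ≤ 1, then w(x,t)/ψ(x,t) ≥ inf{ w(y,0)/ψ(y,0) : y ∈ U, ψ(y,0) > 0 }; if α > 1, then w(x,t)/ψ(x,t) ≥ min{ inf{ w(y,0)/ψ(y,0) : y ∈ U, ψ(y,0) > 0 }, α/(n(α−1)), b/(a(α−1)) }. -/

import Mathlib

noncomputable section
open Set

abbrev En (n : ℕ) := EuclideanSpace ℝ (Fin n)

/-- Partial derivative `∂ᵢ f` at `x`. -/
noncomputable def pd {n : ℕ} (f : En n → ℝ) (i : Fin n) (x : En n) : ℝ :=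
  fderiv ℝ f x (EuclideanSpace.single i 1)

/-- `|∇f|²` at `x`. -/
noncomputable def gradNormSq {n : ℕ} (f : En n → ℝ) (x : En n) : ℝ :=
  ∑ i : Fin n, (pd f i x) ^ 2

/-- `v(f) = √(1+|∇f|²)`. -/
noncomputable def graphV {n : ℕ} (f : En n → ℝ) (x : En n) : ℝ :=
  Real.sqrt (1 + gradNormSq f x)

/-- Mean curvature `H[f] = div(∇f / v(f))` of `graph f`. -/
noncomputable def meanCurv {n : ℕ} (f : En n → ℝ) (x : En n) : ℝ :=
  ∑ i : Fin n, pd (fun y => pd f i y / graphV f y) i x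


/-- The localization function `ψ(x,t) = (a − b·t − u(x,t))₊`. -/
noncomputable def psiF {n : ℕ} (a b : ℝ) (u : En n → ℝ → ℝ) (x : En n) (t : ℝ) : ℝ :=
  max (a - b * t - u x t) 0

/-- `w(x,t) = (1+|∇u(x,t)|²)^{-1/2}`. -/
noncomputable def wF {n : ℕ} (u : En n → ℝ → ℝ) (x : En n) (t : ℝ) : ℝ :=
  1 / Real.sqrt (1 + gradNormSq (fun y => u y t) x)

/-! ### General calculus helpers -/

theorem fderiv_fderiv_symm {E : Type*} [NormedAddCommGroup E] [NormedSpace ℝ E] {f : E → ℝ} {x : E}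
    (hf : ContDiffAt ℝ (⊤ : ℕ∞) f x) (a b : E) :
    fderiv ℝ (fun y => fderiv ℝ f y a) x b = fderiv ℝ (fun y => fderiv ℝ f y b) x a := by
  have hd : DifferentiableAt ℝ (fderiv ℝ f) x := by
    have : ContDiffAt ℝ 1 (fderiv ℝ f) x := hf.fderiv_right (m := 1) 
      (WithTop.coe_le_coe.2 (le_top : ((1 + 1 : ℕ∞)) ≤ ⊤))
    exact this.differentiableAt (by norm_num)
  have hs : IsSymmSndFDerivAt ℝ f x := hf.isSymmSndFDerivAt (by
    simp only [minSmoothness_of_isRCLikeNormedField]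
    exact WithTop.coe_le_coe.2 (le_top : (2 : ℕ∞) ≤ ⊤))
  have key : ∀ a b : E, fderiv ℝ (fun y => fderiv ℝ f y a) x b = fderiv ℝ (fderiv ℝ f) x b a := by
    intro a b
    rw [fderiv_clm_apply hd (differentiableAt_const a)]
    simp
  rw [key, key]
  exact hs b a

/-- At a point that is a maximum from the left, the derivative is nonnegative. -/
theorem deriv_nonneg_of_left_max {f : ℝ → ℝ} {f' t s : ℝ} (hs : s < t) (hf : HasDerivAt f f' t)
    (h : ∀ r, s < r → r < t → f r ≤ f t) : 0 ≤ f' := by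
  have h1 : Filter.Tendsto (slope f t) (nhdsWithin t (Iio t)) (nhds f') :=
    (hasDerivAt_iff_tendsto_slope.1 hf).mono_left
      (nhdsWithin_mono t (fun r hr => (ne_of_lt hr : r ≠ t)))
  refine ge_of_tendsto h1 ?_
  filter_upwards [Ioo_mem_nhdsLT hs] with r hr
  rw [slope_def_field]
  exact div_nonneg_of_nonpos (by linarith [h r hr.1 hr.2]) (by linarith [hr.2])

theorem second_deriv_nonpos_of_localMax {φ : ℝ → ℝ} (h : IsLocalMax φ 0)
    (hc : ContinuousAt φ 0) : deriv (deriv φ) 0 ≤ 0 := by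
  by_contra! hpos
  have hmin := isLocalMin_of_deriv_deriv_pos hpos h.deriv_eq_zero hc
  have he : φ =ᶠ[nhds 0] fun _ => φ 0 := by
    filter_upwards [h, hmin] with y h1 h2
    exact le_antisymm h1 h2
  have h1 : deriv φ =ᶠ[nhds 0] fun _ => (0 : ℝ) := by
    have := he.deriv
    simpa using this
  have := h1.deriv_eq
  simp at this
  linarith

section PD
variable {n : ℕ} {U : Set (En n)}

theorem pd_smooth (hU : IsOpen U) {f : En n → ℝ} (hf : ContDiffOn ℝ (⊤ : ℕ∞) f U) (i : Fin n) :
    ContDiffOn ℝ (⊤ : ℕ∞) (pd f i) U := by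
  have := hf.fderiv_of_isOpen (m := (⊤ : ℕ∞)) hU (by exact_mod_cast le_rfl)
  exact this.clm_apply contDiffOn_const

theorem sm_diff (hU : IsOpen U) {f : En n → ℝ} (hf : ContDiffOn ℝ (⊤ : ℕ∞) f U) {x : En n}
    (hx : x ∈ U) : DifferentiableAt ℝ f x :=
  ((hf.contDiffAt (hU.mem_nhds hx)).differentiableAt (by simp))

theorem pd_congr (hU : IsOpen U) {f g : En n → ℝ} {x : En n} (hx : x ∈ U)
    (h : ∀ y ∈ U, f y = g y) (i : Fin n) : pd f i x = pd g i x := by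
  unfold pd
  rw [Filter.EventuallyEq.fderiv_eq]
  filter_upwards [hU.mem_nhds hx] with y hy using h y hy

theorem pd_add {f g : En n → ℝ} {x : En n} (hf : DifferentiableAt ℝ f x)
    (hg : DifferentiableAt ℝ g x) (i : Fin n) :
    pd (fun y => f y + g y) i x = pd f i x + pd g i x := by
  unfold pd
  rw [fderiv_fun_add hf hg]; rfl

theorem pd_sub {f g : En n → ℝ} {x : En n} (hf : DifferentiableAt ℝ f x)
    (hg : DifferentiableAt ℝ g x) (i : Fin n) :
    pd (fun y => f y - g y) i x = pd f i x - pd g i x := by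
  unfold pd
  rw [fderiv_fun_sub hf hg]; rfl

theorem pd_const (c : ℝ) (x : En n) (i : Fin n) :
    pd (fun _ => c) i x = 0 := by
  unfold pd
  simp

theorem pd_mul {f g : En n → ℝ} {x : En n} (hf : DifferentiableAt ℝ f x)
    (hg : DifferentiableAt ℝ g x) (i : Fin n) :
    pd (fun y => f y * g y) i x = f x * pd g i x + g x * pd f i x := by
  unfold pd
  rw [fderiv_fun_mul hf hg]; simp

theorem pd_sum {ι : Type*} (s : Finset ι) {f : ι → En n → ℝ} {x : En n}
    (hf : ∀ k ∈ s, DifferentiableAt ℝ (f k) x) (i : Fin n) :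
    pd (fun y => ∑ k ∈ s, f k y) i x = ∑ k ∈ s, pd (f k) i x := by
  unfold pd
  rw [fderiv_fun_sum hf]; simp

theorem pd_comm (hU : IsOpen U) {f : En n → ℝ} (hf : ContDiffOn ℝ (⊤ : ℕ∞) f U) {x : En n}
    (hx : x ∈ U) (i j : Fin n) : pd (pd f i) j x = pd (pd f j) i x :=
  fderiv_fderiv_symm (hf.contDiffAt (hU.mem_nhds hx)) _ _

theorem fderiv_eq_sum (f : En n → ℝ) (x ξ : En n) : fderiv ℝ f x ξ = ∑ i, ξ i * pd f i x := by
  have h : ξ = ∑ i, ξ i • EuclideanSpace.single i (1 : ℝ) := by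
    ext j
    simp [Finset.sum_apply, Pi.single_apply]
  conv_lhs => rw [h]
  rw [map_sum]
  simp [pd]

theorem localMax_pd {G : En n → ℝ} {x : En n} (h : IsLocalMax G x) (i : Fin n) :
    pd G i x = 0 := by
  unfold pd
  rw [h.fderiv_eq_zero]; rfl

theorem localMax_hess (hU : IsOpen U) {G : En n → ℝ} (hG : ContDiffOn ℝ (⊤ : ℕ∞) G U) {x : En n}
    (hx : x ∈ U) (h : IsLocalMax G x) (ξ : Fin n → ℝ) :
    ∑ i, ∑ j, ξ i * ξ j * pd (pd G j) i x ≤ 0 := by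
  set z : En n := WithLp.toLp 2 ξ with hz
  have hzi : ∀ i, z i = ξ i := fun i => rfl
  let ℓ : ℝ → En n := fun s => x + s • z
  have hℓ0 : ℓ 0 = x := by simp [ℓ]
  have hℓ : ∀ s, HasDerivAt ℓ z s := by
    intro s
    have := ((hasDerivAt_id s).smul_const z).const_add x
    simpa [ℓ] using this
  have hUev : ∀ᶠ s in nhds (0 : ℝ), ℓ s ∈ U :=
    (hℓ 0).continuousAt.eventually (by rw [hℓ0]; exact hU.mem_nhds hx)
  have hder : ∀ F : En n → ℝ, ContDiffOn ℝ (⊤ : ℕ∞) F U → ∀ s, ℓ s ∈ U →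
      HasDerivAt (fun s => F (ℓ s)) (∑ i, ξ i * pd F i (ℓ s)) s := by
    intro F hF s hs
    have := (sm_diff hU hF hs).hasFDerivAt.comp_hasDerivAt s (hℓ s)
    rw [fderiv_eq_sum] at this
    exact this
  have hmax : IsLocalMax (fun s => G (ℓ s)) 0 := by
    have : Filter.Tendsto ℓ (nhds 0) (nhds x) := by
      have := (hℓ 0).continuousAt.tendsto
      rwa [hℓ0] at this
    have := this.eventually h
    filter_upwards [this] with s hs
    simpa [hℓ0] using hs
  have hx' : ℓ 0 ∈ U := by rw [hℓ0]; exact hx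
  have h2 := second_deriv_nonpos_of_localMax hmax (hder G hG 0 hx').continuousAt
  have h3 : deriv (fun s => G (ℓ s)) =ᶠ[nhds 0] fun s => ∑ j, ξ j * pd G j (ℓ s) := by
    filter_upwards [hUev] with s hs using (hder G hG s hs).deriv
  rw [h3.deriv_eq] at h2
  have h4 : HasDerivAt (fun s => ∑ j, ξ j * pd G j (ℓ s))
      (∑ j, ξ j * ∑ i, ξ i * pd (pd G j) i (ℓ 0)) 0 := by
    apply HasDerivAt.fun_sum
    intro j _
    exact (hder _ (pd_smooth hU hG j) 0 hx').const_mul _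
  rw [h4.deriv, hℓ0] at h2
  refine le_of_eq_of_le ?_ h2
  rw [Finset.sum_comm]
  refine Finset.sum_congr rfl fun j _ => ?_
  rw [Finset.mul_sum]
  refine Finset.sum_congr rfl fun i _ => ?_
  ring

end PD

/-- Contraction of a negative semidefinite form with `S δ - p pᵀ`. -/
theorem contract_nonpos {n : ℕ} (p : Fin n → ℝ) (Q : Fin n → Fin n → ℝ)
    (h : ∀ ξ : Fin n → ℝ, ∑ i, ∑ j, ξ i * ξ j * Q i j ≤ 0) :
    (1 + ∑ i, p i ^ 2) * ∑ i, Q i i - ∑ i, ∑ j, p i * p j * Q i j ≤ 0 := by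
  have hd : ∀ i, Q i i ≤ 0 := by
    intro i
    have := h (Pi.single i 1)
    simpa [Pi.single_apply] using this
  have ho : ∀ i j, p i ^ 2 * Q j j + p j ^ 2 * Q i i - p i * p j * Q i j - p j * p i * Q j i ≤ 0 := by
    intro i j
    have := h (fun k => p i * (if k = j then 1 else 0) - p j * (if k = i then 1 else 0))
    refine le_of_eq_of_le ?_ this
    simp only [sub_mul, mul_sub, Finset.sum_sub_distrib]
    simp
    ring
  have hs : ∑ i, ∑ j, (p i ^ 2 * Q j j + p j ^ 2 * Q i i - p i * p j * Q i j - p j * p i * Q j i) ≤ 0 :=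
    Finset.sum_nonpos fun i _ => Finset.sum_nonpos fun j _ => ho i j
  have e1 : ∑ i, ∑ j, p i ^ 2 * Q j j = (∑ i, p i ^ 2) * ∑ i, Q i i := by
    rw [Finset.sum_mul_sum]
  have e2 : ∑ i, ∑ j, p j ^ 2 * Q i i = (∑ i, p i ^ 2) * ∑ i, Q i i := by
    rw [Finset.sum_comm, Finset.sum_mul_sum]
  have e3 : ∑ i, ∑ j, p j * p i * Q j i = ∑ i, ∑ j, p i * p j * Q i j := Finset.sum_comm
  simp only [Finset.sum_sub_distrib, Finset.sum_add_distrib] at hs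
  rw [e1, e2, e3] at hs
  have := Finset.sum_nonpos (s := Finset.univ) (fun i _ => hd i)
  nlinarith

/-- The scalar part of the maximum-principle computation. -/
theorem scalar_core {N S r e q H DH τ a2 d : ℝ} (hN : 0 < N) (hq : 0 < q) (hS : S = 1 + r)
    (hqS : q ^ 2 = S)
    (h1 : S * a2 + d ≤ 3 * S * r * e ^ 2 + S ^ 2 * e * τ)
    (h2 : H * q ^ 3 = S * τ - S * e * r)
    (h3 : DH * q ^ 3 + 3 * H * q * (S * r * e) = 2 * S * r * e * τ + d - 2 * (S * e) ^ 2 * r)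
    (h4 : (τ - r * e) ^ 2 ≤ N * (a2 - 2 * S * e ^ 2 * r + r ^ 2 * e ^ 2)) :
    DH ≤ H * e - q * H ^ 2 / N := by
  have hSpos : 0 < S := by rw [← hqS]; positivity
  have hτ : τ = q * H + r * e := by
    have : S * τ = S * (q * H + r * e) := by
      rw [← hqS] at h2 ⊢
      linear_combination -h2
    exact mul_left_cancel₀ hSpos.ne' this
  have h4' : q ^ 2 * H ^ 2 / N ≤ a2 - 2 * S * e ^ 2 * r + r ^ 2 * e ^ 2 := by
    rw [div_le_iff₀ hN]
    have : (τ - r * e) ^ 2 = q ^ 2 * H ^ 2 := by rw [hτ]; ring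
    linarith
  have h5 := mul_le_mul_of_nonneg_left h4' hSpos.le
  have key : DH * q ^ 3 ≤ (H * e - q * H ^ 2 / N) * q ^ 3 := by
    have e1 : DH * q ^ 3 = 2 * S * r * e * τ + d - 2 * (S * e) ^ 2 * r - 3 * H * q * (S * r * e) := by
      linarith
    have e2 : (H * e - q * H ^ 2 / N) * q ^ 3 = q * S * H * e - S * (q ^ 2 * H ^ 2 / N) := by
      rw [← hqS]; ring
    rw [e1, e2]
    have e3 : 2 * S * r * e * τ + (3 * S * r * e ^ 2 + S ^ 2 * e * τ
        - S * (2 * S * e ^ 2 * r - r ^ 2 * e ^ 2)) - 2 * (S * e) ^ 2 * r - 3 * H * q * (S * r * e)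
        = q * S * H * e := by
      rw [hτ, hS]; ring
    nlinarith
  exact le_of_mul_le_mul_right key (by positivity)

/-- The linear-algebra part of the maximum-principle computation. -/
theorem algebra_core {n : ℕ} (hn : 1 ≤ n) (p : Fin n → ℝ) (A DA : Fin n → Fin n → ℝ)
    (S ψ q H DH Dq : ℝ) (hψ : 0 < ψ) (hq : 0 < q) (hS : S = 1 + ∑ i, p i ^ 2) (hqS : q ^ 2 = S)
    (hA : ∀ i j, A i j = A j i)
    (hE : ∀ k, ψ * ∑ i, A k i * p i = S * p k)
    (hQ : ∀ ξ : Fin n → ℝ, ∑ i, ∑ j, ξ i * ξ j * (2 * ψ ^ 2 * (∑ k, A k i * A k j + DA i j)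
      - 6 * S * p i * p j - 2 * S * ψ * A i j) ≤ 0)
    (hDq : ψ * (q * Dq) = S * ∑ i, p i ^ 2)
    (hH : H * q ^ 3 = S * ∑ i, A i i - ∑ i, ∑ k, p i * p k * A k i)
    (hDH : DH * q ^ 3 + 3 * H * q ^ 2 * Dq = 2 * (q * Dq) * ∑ i, A i i + S * ∑ i, DA i i
      - ∑ i, ∑ k, ((∑ j, A i j * p j) * p k * A k i + p i * (∑ j, A k j * p j) * A k i
        + p i * p k * DA k i)) :
    DH ≤ H / ψ - q * H ^ 2 / n := by
  set r := ∑ i, p i ^ 2 with hr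
  set e := ψ⁻¹ with he
  have heψ : ψ * e = 1 := mul_inv_cancel₀ hψ.ne'
  have hE' : ∀ k, ∑ i, A k i * p i = S * e * p k := by
    intro k
    linear_combination e * hE k - (∑ i, A k i * p i) * heψ
  have hDq' : q * Dq = S * r * e := by
    linear_combination e * hDq - (q * Dq) * heψ
  -- quadratic form of A
  have hpAp : ∑ i, ∑ k, p i * p k * A k i = S * e * r := by
    rw [hr, Finset.mul_sum]
    refine Finset.sum_congr rfl fun i _ => ?_
    have := hE' i
    calc ∑ k, p i * p k * A k i = p i * ∑ k, A i k * p k := by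
          rw [Finset.mul_sum]; exact Finset.sum_congr rfl fun k _ => by rw [hA k i]; ring
      _ = _ := by rw [this]; ring
  have hpApT : ∑ i, ∑ k, p i * p k * A i k = S * e * r := by
    rw [← hpAp]
    exact Finset.sum_congr rfl fun i _ => Finset.sum_congr rfl fun k _ => by rw [hA i k]
  have hpA2p : ∑ i, ∑ j, p i * p j * (∑ k, A k i * A k j) = (S * e) ^ 2 * r := by
    calc ∑ i, ∑ j, p i * p j * (∑ k, A k i * A k j)
        = ∑ k, (∑ i, A k i * p i) * (∑ j, A k j * p j) := by
          simp_rw [Finset.sum_mul_sum, Finset.mul_sum]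
          conv_rhs => rw [Finset.sum_comm]
          refine Finset.sum_congr rfl fun i _ => ?_
          rw [Finset.sum_comm]
          refine Finset.sum_congr rfl fun k _ => Finset.sum_congr rfl fun j _ => ?_
          ring
      _ = _ := by
          simp_rw [hE']
          rw [hr, Finset.mul_sum]
          exact Finset.sum_congr rfl fun k _ => by ring
  set τ := ∑ i, A i i with hτ
  set a2 := ∑ i, ∑ k, A k i * A k i with ha2
  set tD := ∑ i, DA i i with htD
  set pD := ∑ i, ∑ k, p i * p k * DA i k with hpD
  have hpD' : ∑ i, ∑ k, p i * p k * DA k i = pD := by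
    rw [hpD, Finset.sum_comm]
    exact Finset.sum_congr rfl fun i _ => Finset.sum_congr rfl fun k _ => by ring
  have hpp : ∑ i, ∑ j, p i * p j * (p i * p j) = r ^ 2 := by
    rw [hr, sq, Finset.sum_mul_sum]
    exact Finset.sum_congr rfl fun i _ => Finset.sum_congr rfl fun k _ => by ring
  have hc := contract_nonpos p _ hQ
  have c1 : ∑ i, (2 * ψ ^ 2 * (∑ k, A k i * A k i + DA i i)
      - 6 * S * p i * p i - 2 * S * ψ * A i i)
      = 2 * ψ ^ 2 * (a2 + tD) - 6 * S * r - 2 * S * ψ * τ := by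
    rw [Finset.sum_sub_distrib, Finset.sum_sub_distrib, ← Finset.mul_sum, Finset.sum_add_distrib,
      ← Finset.mul_sum, hr, Finset.mul_sum (a := 6 * S)]
    congr 2
    exact Finset.sum_congr rfl fun i _ => by ring
  have c2 : ∑ i, ∑ j, p i * p j * (2 * ψ ^ 2 * (∑ k, A k i * A k j + DA i j)
      - 6 * S * p i * p j - 2 * S * ψ * A i j)
      = 2 * ψ ^ 2 * ((S * e) ^ 2 * r + pD) - 6 * S * r ^ 2 - 2 * S * ψ * (S * e * r) := by
    rw [← hpA2p, hpD, ← hpp, ← hpApT]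
    simp only [Finset.mul_sum (a := 6 * S), Finset.mul_sum (a := 2 * S * ψ),
      Finset.mul_sum (a := 2 * ψ ^ 2), ← Finset.sum_add_distrib, ← Finset.sum_sub_distrib]
    refine Finset.sum_congr rfl fun i _ => Finset.sum_congr rfl fun j _ => ?_
    ring
  rw [c1, c2, ← hr, ← hS] at hc
  have hne : (0 : ℝ) < n := by exact_mod_cast hn
  have d3 : ∑ i, ∑ k, ((∑ j, A i j * p j) * p k * A k i + p i * (∑ j, A k j * p j) * A k i
        + p i * p k * DA k i) = 2 * (S * e) ^ 2 * r + pD := by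
    have : 2 * (S * e) ^ 2 * r + pD = 2 * (S * e) * (∑ i, ∑ k, p i * p k * A k i) + pD := by
      rw [hpAp]; ring
    rw [this, ← hpD', Finset.mul_sum, ← Finset.sum_add_distrib]
    simp_rw [hE']
    refine Finset.sum_congr rfl fun i _ => ?_
    rw [Finset.mul_sum, ← Finset.sum_add_distrib]
    refine Finset.sum_congr rfl fun j _ => ?_
    ring
  rw [d3] at hDH
  -- Cauchy-Schwarz
  have hCS : (τ - r * e) ^ 2 ≤ n * (a2 - 2 * S * e ^ 2 * r + r ^ 2 * e ^ 2) := by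
    have t1 : τ - r * e = ∑ i, (A i i - e * (p i * p i)) := by
      rw [Finset.sum_sub_distrib, ← Finset.mul_sum, hτ, hr]
      simp_rw [sq]
      ring
    have t2 : a2 - 2 * S * e ^ 2 * r + r ^ 2 * e ^ 2
        = ∑ i, ∑ j, (A j i - e * (p i * p j)) ^ 2 := by
      have : a2 - 2 * S * e ^ 2 * r + r ^ 2 * e ^ 2
        = a2 - 2 * e * (S * e * r) + e ^ 2 * r ^ 2 := by ring
      rw [this, ← hpAp, ← hpp, ha2]
      simp only [Finset.mul_sum, ← Finset.sum_add_distrib, ← Finset.sum_sub_distrib]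
      refine Finset.sum_congr rfl fun i _ => Finset.sum_congr rfl fun j _ => ?_
      ring
    rw [t1, t2]
    have t3 := sq_sum_le_card_mul_sum_sq (s := (Finset.univ : Finset (Fin n)))
      (f := fun i => A i i - e * (p i * p i))
    simp only [Finset.card_univ, Fintype.card_fin] at t3
    refine t3.trans (mul_le_mul_of_nonneg_left ?_ hne.le)
    refine Finset.sum_le_sum fun i _ => ?_
    exact Finset.single_le_sum (f := fun j => (A j i - e * (p i * p j)) ^ 2)
      (fun j _ => sq_nonneg _) (Finset.mem_univ i)
  have h1 : S * a2 + (S * tD - pD) ≤ 3 * S * r * e ^ 2 + S ^ 2 * e * τ := by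
    have hmul := mul_le_mul_of_nonneg_left hc (by positivity : 0 ≤ e ^ 2 / 2)
    have h2e : ψ ^ 2 * e ^ 2 = 1 := by rw [← mul_pow, heψ]; norm_num
    have hSr : S - r = 1 := by rw [hS]; ring
    have : e ^ 2 / 2 * (S * (2 * ψ ^ 2 * (a2 + tD) - 6 * S * r - 2 * S * ψ * τ) -
        (2 * ψ ^ 2 * ((S * e) ^ 2 * r + pD) - 6 * S * r ^ 2 - 2 * S * ψ * (S * e * r)))
        = S * a2 + (S * tD - pD) - (3 * S * r * e ^ 2 + S ^ 2 * e * τ) := by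
      linear_combination (S * (a2 + tD) - ((S * e) ^ 2 * r + pD)) * h2e
        - 3 * S * r * e ^ 2 * hSr + (- S ^ 2 * e * τ + S * e * (S * e * r)) * heψ
    rw [this, mul_zero] at hmul
    linarith
  have := scalar_core (N := (n : ℝ)) (S := S) (r := r) (e := e) (q := q) (H := H) (DH := DH) (τ := τ)
    (a2 := a2) (d := S * tD - pD) hne hq hS hqS h1 (by rw [hH, hpAp]) (by
      have x1 : 3 * H * q ^ 2 * Dq = 3 * H * q * (S * r * e) := by rw [← hDq']; ring
      rw [x1, hDq'] at hDH
      rw [hDH]; ring) hCS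
  rwa [div_eq_mul_inv]

section Spatial
variable {n : ℕ} {U : Set (En n)}

theorem gradNormSq_nonneg (f : En n → ℝ) (x : En n) : 0 ≤ gradNormSq f x :=
  Finset.sum_nonneg fun _ _ => sq_nonneg _

theorem graphV_pos (f : En n → ℝ) (x : En n) : 0 < graphV f x :=
  Real.sqrt_pos.2 (by linarith [gradNormSq_nonneg f x])

theorem graphV_sq (f : En n → ℝ) (x : En n) : graphV f x ^ 2 = 1 + gradNormSq f x :=
  Real.sq_sqrt (by linarith [gradNormSq_nonneg f x])

theorem sm_gradNormSq (hU : IsOpen U) {f : En n → ℝ} (hf : ContDiffOn ℝ (⊤ : ℕ∞) f U) :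
    ContDiffOn ℝ (⊤ : ℕ∞) (gradNormSq f) U := by
  unfold gradNormSq
  exact ContDiffOn.sum fun i _ => (pd_smooth hU hf i).pow 2

theorem sm_graphV (hU : IsOpen U) {f : En n → ℝ} (hf : ContDiffOn ℝ (⊤ : ℕ∞) f U) :
    ContDiffOn ℝ (⊤ : ℕ∞) (graphV f) U := by
  unfold graphV
  exact (contDiffOn_const.add (sm_gradNormSq hU hf)).sqrt
    (fun x _ => by linarith [gradNormSq_nonneg f x])

theorem sm_meanCurv (hU : IsOpen U) {f : En n → ℝ} (hf : ContDiffOn ℝ (⊤ : ℕ∞) f U) :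
    ContDiffOn ℝ (⊤ : ℕ∞) (meanCurv f) U := by
  unfold meanCurv
  exact ContDiffOn.sum fun i _ => pd_smooth hU
    ((pd_smooth hU hf i).div (sm_graphV hU hf) fun x _ => (graphV_pos f x).ne') i

theorem pd_gradNormSq (hU : IsOpen U) {f : En n → ℝ} (hf : ContDiffOn ℝ (⊤ : ℕ∞) f U) {x : En n}
    (hx : x ∈ U) (j : Fin n) :
    pd (gradNormSq f) j x = 2 * ∑ k, pd f k x * pd (pd f k) j x := by
  have hP := fun k => sm_diff hU (pd_smooth hU hf k) hx
  have : gradNormSq f = fun y => ∑ k, pd f k y * pd f k y := by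
    funext y; unfold gradNormSq; exact Finset.sum_congr rfl fun k _ => sq _
  rw [this, pd_sum _ (fun k _ => (hP k).fun_mul (hP k)), Finset.mul_sum]
  refine Finset.sum_congr rfl fun k _ => ?_
  rw [pd_mul (hP k) (hP k)]
  ring

theorem pd_graphV (hU : IsOpen U) {f : En n → ℝ} (hf : ContDiffOn ℝ (⊤ : ℕ∞) f U) {x : En n}
    (hx : x ∈ U) (j : Fin n) :
    graphV f x * pd (graphV f) j x = ∑ k, pd f k x * pd (pd f k) j x := by
  have hV := sm_diff hU (sm_graphV hU hf) hx
  have h1 : pd (fun y => graphV f y * graphV f y) j x = pd (fun y => 1 + gradNormSq f y) j x := by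
    congr 1; funext y; rw [← graphV_sq, sq]
  rw [pd_mul hV hV, pd_add (differentiableAt_const _) (sm_diff hU (sm_gradNormSq hU hf) hx),
    pd_const, pd_gradNormSq hU hf hx] at h1
  linarith

theorem meanCurv_eq (hU : IsOpen U) {f : En n → ℝ} (hf : ContDiffOn ℝ (⊤ : ℕ∞) f U) {x : En n}
    (hx : x ∈ U) :
    meanCurv f x * (graphV f x * (graphV f x * graphV f x)) = (1 + gradNormSq f x) * ∑ i, pd (pd f i) i x
      - ∑ i, ∑ k, pd f i x * pd f k x * pd (pd f k) i x := by
  have hV := sm_diff hU (sm_graphV hU hf) hx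
  have hV0 := (graphV_pos f x).ne'
  have hi : ∀ i, pd (fun y => pd f i y / graphV f y) i x * (graphV f x * (graphV f x * graphV f x))
      = (1 + gradNormSq f x) * pd (pd f i) i x - ∑ k, pd f i x * pd f k x * pd (pd f k) i x := by
    intro i
    have hP := sm_diff hU (pd_smooth hU hf i) hx
    have hQ := sm_diff hU ((pd_smooth hU hf i).div (sm_graphV hU hf)
      fun x _ => (graphV_pos f x).ne') hx
    have h1 : pd (fun y => pd f i y / graphV f y * graphV f y) i x = pd (pd f i) i x :=
      pd_congr hU hx (fun y _ => div_mul_cancel₀ _ (graphV_pos f y).ne') i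
    rw [pd_mul (f := fun y => pd f i y / graphV f y) hQ hV] at h1
    have h2 := pd_graphV hU hf hx i
    have h3 : ∑ k, pd f i x * pd f k x * pd (pd f k) i x
        = pd f i x * (graphV f x * pd (graphV f) i x) := by
      rw [h2, Finset.mul_sum]; exact Finset.sum_congr rfl fun k _ => by ring
    rw [h3, ← graphV_sq, ← h1]
    field_simp
    ring
  unfold meanCurv
  rw [Finset.sum_mul, Finset.sum_congr rfl fun i _ => hi i, Finset.sum_sub_distrib, Finset.mul_sum]

theorem spatial_core (hn : 1 ≤ n) (hU : IsOpen U) {f : En n → ℝ} (hf : ContDiffOn ℝ (⊤ : ℕ∞) f U)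
    {x : En n} (hx : x ∈ U) (κ : ℝ) (hψ : 0 < κ - f x)
    (hmax : IsLocalMax (fun y => (1 + gradNormSq f y) * ((κ - f y) * (κ - f y))) x) :
    (κ - f x) * ∑ i, pd f i x * pd (graphV f) i x = graphV f x * gradNormSq f x ∧
    ∑ i, pd f i x * pd (meanCurv f) i x ≤
      meanCurv f x / (κ - f x) - graphV f x * meanCurv f x ^ 2 / n := by
  have dP (k : Fin n) {y : En n} (hy : y ∈ U) := sm_diff hU (pd_smooth hU hf k) hy
  have dPP (k i : Fin n) {y : En n} (hy : y ∈ U) :=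
    sm_diff hU (pd_smooth hU (pd_smooth hU hf k) i) hy
  have dS {y : En n} (hy : y ∈ U) := sm_diff hU (sm_gradNormSq hU hf) hy
  have dV {y : En n} (hy : y ∈ U) := sm_diff hU (sm_graphV hU hf) hy
  have dH {y : En n} (hy : y ∈ U) := sm_diff hU (sm_meanCurv hU hf) hy
  have df {y : En n} (hy : y ∈ U) := sm_diff hU hf hy
  have sψ : ContDiffOn ℝ (⊤ : ℕ∞) (fun y => κ - f y) U := contDiffOn_const.sub hf
  have dψ {y : En n} (hy : y ∈ U) := sm_diff hU sψ hy
  have sS1 : ContDiffOn ℝ (⊤ : ℕ∞) (fun y => 1 + gradNormSq f y) U :=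
    contDiffOn_const.add (sm_gradNormSq hU hf)
  have dS1 {y : En n} (hy : y ∈ U) := sm_diff hU sS1 hy
  have sG : ContDiffOn ℝ (⊤ : ℕ∞) (fun y => (1 + gradNormSq f y) * ((κ - f y) * (κ - f y))) U :=
    sS1.mul (sψ.mul sψ)
  have pψ : ∀ y ∈ U, ∀ j, pd (fun y => κ - f y) j y = - pd f j y := by
    intro y hy j
    rw [pd_sub (differentiableAt_const _) (df hy), pd_const]; ring
  have pS1 : ∀ y ∈ U, ∀ j, pd (fun y => 1 + gradNormSq f y) j y = pd (gradNormSq f) j y := by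
    intro y hy j
    rw [pd_add (differentiableAt_const _) (dS hy), pd_const]; ring
  have pG : ∀ y ∈ U, ∀ j, pd (fun y => (1 + gradNormSq f y) * ((κ - f y) * (κ - f y))) j y
      = ((κ - f y) * (κ - f y)) * pd (gradNormSq f) j y
        - 2 * ((1 + gradNormSq f y) * ((κ - f y) * pd f j y)) := by
    intro y hy j
    rw [pd_mul (f := fun y => 1 + gradNormSq f y) (g := fun y => (κ - f y) * (κ - f y)) (dS1 hy)
      ((dψ hy).fun_mul (dψ hy)), pd_mul (f := fun y => κ - f y) (g := fun y => κ - f y) (dψ hy) (dψ hy),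
      pψ y hy, pS1 y hy]
    ring
  set ψ := κ - f x with hψdef
  set S := 1 + gradNormSq f x with hSdef
  -- first-order condition
  have hfirst : ∀ j, ψ * pd (gradNormSq f) j x = 2 * S * pd f j x := by
    intro j
    have h0 := localMax_pd hmax j
    rw [pG x hx j, ← hψdef, ← hSdef] at h0
    have : ψ * (ψ * pd (gradNormSq f) j x - 2 * S * pd f j x) = 0 := by linarith
    rcases mul_eq_zero.1 this with h | h
    · exact absurd h hψ.ne'
    · linarith
  have hAsym : ∀ i j, pd (pd f i) j x = pd (pd f j) i x := fun i j => pd_comm hU hf hx i j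
  have hBsym1 : ∀ i j k, pd (pd (pd f i) j) k x = pd (pd (pd f j) i) k x := fun i j k =>
    pd_congr hU hx (fun y hy => pd_comm hU hf hy i j) k
  have hBsym2 : ∀ i j k, pd (pd (pd f i) j) k x = pd (pd (pd f i) k) j x := fun i j k =>
    pd_comm hU (pd_smooth hU hf i) hx j k
  have hE : ∀ k, ψ * ∑ i, pd (pd f k) i x * pd f i x = S * pd f k x := by
    intro k
    have h1 := hfirst k
    rw [pd_gradNormSq hU hf hx k] at h1
    have h2 : ∑ i, pd (pd f k) i x * pd f i x = ∑ i, pd f i x * pd (pd f i) k x :=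
      Finset.sum_congr rfl fun i _ => by rw [hAsym k i]; ring
    rw [h2]; linarith
  have hVV : graphV f x * ∑ i, pd f i x * pd (graphV f) i x
      = ∑ i, pd f i x * ∑ k, pd (pd f i) k x * pd f k x := by
    rw [Finset.mul_sum]
    refine Finset.sum_congr rfl fun i _ => ?_
    have := pd_graphV hU hf hx i
    calc _ = pd f i x * (graphV f x * pd (graphV f) i x) := by ring
      _ = _ := by
        rw [this]; congr 1
        exact Finset.sum_congr rfl fun k _ => by rw [hAsym k i]; ring
  have hDq : ψ * (graphV f x * ∑ i, pd f i x * pd (graphV f) i x) = S * ∑ i, pd f i x ^ 2 := by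
    rw [hVV, Finset.mul_sum, Finset.mul_sum]
    refine Finset.sum_congr rfl fun i _ => ?_
    linear_combination pd f i x * hE i
  have hV0 := graphV_pos f x
  have hVS : graphV f x ^ 2 = S := graphV_sq f x
  refine ⟨?_, ?_⟩
  · apply mul_left_cancel₀ hV0.ne'
    have : gradNormSq f x = ∑ i, pd f i x ^ 2 := rfl
    rw [this, ← mul_assoc (graphV f x) (graphV f x), ← sq, hVS, ← hDq]
    ring
  -- second-order condition
  have pdS2 : ∀ i j, pd (pd (gradNormSq f) j) i x
      = 2 * (∑ k, pd (pd f k) i x * pd (pd f k) j x + ∑ k, pd f k x * pd (pd (pd f i) j) k x) := by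
    intro i j
    have e0 : pd (pd (gradNormSq f) j) i x
        = pd (fun y => 2 * ∑ k, pd f k y * pd (pd f k) j y) i x :=
      pd_congr hU hx (fun y hy => pd_gradNormSq hU hf hy j) i
    have dm : ∀ k ∈ (Finset.univ : Finset (Fin n)),
        DifferentiableAt ℝ (fun y => pd f k y * pd (pd f k) j y) x :=
      fun k _ => (dP k hx).fun_mul (dPP k j hx)
    rw [e0, pd_mul (differentiableAt_const _) (DifferentiableAt.fun_sum dm), pd_const, pd_sum _ dm,
      ← Finset.sum_add_distrib, mul_zero, add_zero]
    congr 1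
    refine Finset.sum_congr rfl fun k _ => ?_
    rw [pd_mul (dP k hx) (dPP k j hx), hBsym2 k j i, hBsym1 k i j, hBsym2 i k j]
    ring
  have hGG : ∀ i j, pd (pd (fun y => (1 + gradNormSq f y) * ((κ - f y) * (κ - f y))) j) i x
      = 2 * ψ ^ 2 * (∑ k, pd (pd f k) i x * pd (pd f k) j x + ∑ k, pd f k x * pd (pd (pd f i) j) k x)
      - 6 * S * pd f i x * pd f j x - 2 * S * ψ * pd (pd f i) j x := by
    intro i j
    rw [pd_congr hU hx (fun y hy => pG y hy j) i]
    have d1 : DifferentiableAt ℝ (pd (gradNormSq f) j) x :=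
      sm_diff hU (pd_smooth hU (sm_gradNormSq hU hf) j) hx
    have d2 : DifferentiableAt ℝ (fun y => (κ - f y) * (κ - f y)) x := (dψ hx).fun_mul (dψ hx)
    have d3 : DifferentiableAt ℝ (fun y => (κ - f y) * pd f j y) x := (dψ hx).fun_mul (dP j hx)
    have d4 : DifferentiableAt ℝ (fun y => (1 + gradNormSq f y) * ((κ - f y) * pd f j y)) x :=
      (dS1 hx).fun_mul d3
    rw [pd_sub (d2.fun_mul d1) ((differentiableAt_const _).fun_mul d4), pd_mul d2 d1,
      pd_mul (differentiableAt_const _) d4, pd_const, pd_mul (dS1 hx) d3,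
      pd_mul (dψ hx) (dP j hx), pd_mul (dψ hx) (dψ hx), pψ x hx, pS1 x hx, pdS2, hAsym j i,
      ← hψdef, ← hSdef]
    linear_combination (-2 * pd f i x) * hfirst j - 2 * pd f j x * hfirst i
  have hQ := localMax_hess hU sG hx hmax
  simp_rw [hGG] at hQ
  -- derivative of the mean curvature
  have hHeq := meanCurv_eq hU hf hx
  have hDj : ∀ j, pd (meanCurv f) j x * graphV f x ^ 3
        + 3 * meanCurv f x * graphV f x ^ 2 * pd (graphV f) j x
      = 2 * (graphV f x * pd (graphV f) j x) * ∑ i, pd (pd f i) i x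
        + S * ∑ i, pd (pd (pd f i) i) j x
        - ∑ i, ∑ k, (pd (pd f i) j x * pd f k x * pd (pd f k) i x
          + pd f i x * pd (pd f k) j x * pd (pd f k) i x
          + pd f i x * pd f k x * pd (pd (pd f k) i) j x) := by
    intro j
    have e := pd_congr hU hx (fun y hy => meanCurv_eq hU hf hy) j
    have dVV : DifferentiableAt ℝ (fun y => graphV f y * graphV f y) x := (dV hx).fun_mul (dV hx)
    have dVVV : DifferentiableAt ℝ (fun y => graphV f y * (graphV f y * graphV f y)) x :=
      (dV hx).fun_mul dVV
    have dt : DifferentiableAt ℝ (fun y => ∑ i, pd (pd f i) i y) x :=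
      DifferentiableAt.fun_sum fun i _ => dPP i i hx
    have dpp : ∀ i k, DifferentiableAt ℝ (fun y => pd f i y * pd f k y) x :=
      fun i k => (dP i hx).fun_mul (dP k hx)
    have dppp : ∀ i k, DifferentiableAt ℝ (fun y => pd f i y * pd f k y * pd (pd f k) i y) x :=
      fun i k => (dpp i k).fun_mul (dPP k i hx)
    have ds : ∀ i, DifferentiableAt ℝ (fun y => ∑ k, pd f i y * pd f k y * pd (pd f k) i y) x :=
      fun i => DifferentiableAt.fun_sum fun k _ => dppp i k
    have dss : DifferentiableAt ℝ (fun y => ∑ i, ∑ k, pd f i y * pd f k y * pd (pd f k) i y) x :=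
      DifferentiableAt.fun_sum fun i _ => ds i
    rw [pd_mul (dH hx) dVVV, pd_mul (dV hx) dVV, pd_mul (dV hx) (dV hx),
      pd_sub ((dS1 hx).fun_mul dt) dss, pd_mul (dS1 hx) dt, pS1 x hx,
      pd_sum _ (fun i _ => dPP i i hx), pd_sum _ (fun i _ => ds i)] at e
    have e2 : ∀ i, pd (fun y => ∑ k, pd f i y * pd f k y * pd (pd f k) i y) j x
        = ∑ k, (pd (pd f i) j x * pd f k x * pd (pd f k) i x
          + pd f i x * pd (pd f k) j x * pd (pd f k) i x
          + pd f i x * pd f k x * pd (pd (pd f k) i) j x) := by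
      intro i
      rw [pd_sum _ (fun k _ => dppp i k)]
      refine Finset.sum_congr rfl fun k _ => ?_
      rw [pd_mul (dpp i k) (dPP k i hx), pd_mul (dP i hx) (dP k hx)]
      ring
    rw [Finset.sum_congr rfl fun i _ => e2 i] at e
    have e3 : pd (gradNormSq f) j x = 2 * (graphV f x * pd (graphV f) j x) := by
      rw [pd_gradNormSq hU hf hx, pd_graphV hU hf hx]
    rw [e3, ← hSdef] at e
    linear_combination e
  have hDH : (∑ j, pd f j x * pd (meanCurv f) j x) * graphV f x ^ 3
        + 3 * meanCurv f x * graphV f x ^ 2 * (∑ j, pd f j x * pd (graphV f) j x)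
      = 2 * (graphV f x * ∑ j, pd f j x * pd (graphV f) j x) * ∑ i, pd (pd f i) i x
        + S * ∑ i, ∑ j, pd f j x * pd (pd (pd f i) i) j x
        - ∑ i, ∑ k, ((∑ j, pd (pd f i) j x * pd f j x) * pd f k x * pd (pd f k) i x
          + pd f i x * (∑ j, pd (pd f k) j x * pd f j x) * pd (pd f k) i x
          + pd f i x * pd f k x * ∑ j, pd f j x * pd (pd (pd f k) i) j x) := by
    have hsum := Finset.sum_congr (rfl : (Finset.univ : Finset (Fin n)) = Finset.univ)
      (fun j _ => congrArg (fun z => pd f j x * z) (hDj j))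
    simp only [mul_add, mul_sub, Finset.sum_add_distrib, Finset.sum_sub_distrib] at hsum
    have t1 : ∑ j, pd f j x * (S * ∑ i, pd (pd (pd f i) i) j x)
        = S * ∑ i, ∑ j, pd f j x * pd (pd (pd f i) i) j x := by
      rw [Finset.sum_comm, Finset.mul_sum]
      refine Finset.sum_congr rfl fun j _ => ?_
      rw [← Finset.mul_sum]; ring
    have t2 : ∀ F : Fin n → Fin n → Fin n → ℝ, ∑ j, pd f j x * ∑ i, ∑ k, F i k j
        = ∑ i, ∑ k, ∑ j, pd f j x * F i k j := by
      intro F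
      simp_rw [Finset.mul_sum]
      rw [Finset.sum_comm]
      refine Finset.sum_congr rfl fun i _ => ?_
      rw [Finset.sum_comm]
    rw [t1, t2 (fun i k j => pd (pd f i) j x * pd f k x * pd (pd f k) i x),
      t2 (fun i k j => pd f i x * pd (pd f k) j x * pd (pd f k) i x),
      t2 (fun i k j => pd f i x * pd f k x * pd (pd (pd f k) i) j x)] at hsum
    have u1 : ∑ j, pd f j x * (pd (meanCurv f) j x * graphV f x ^ 3)
        = (∑ j, pd f j x * pd (meanCurv f) j x) * graphV f x ^ 3 := by
      rw [Finset.sum_mul]; exact Finset.sum_congr rfl fun j _ => by ring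
    have u2 : ∑ j, pd f j x * (3 * meanCurv f x * graphV f x ^ 2 * pd (graphV f) j x)
        = 3 * meanCurv f x * graphV f x ^ 2 * (∑ j, pd f j x * pd (graphV f) j x) := by
      rw [Finset.mul_sum]; exact Finset.sum_congr rfl fun j _ => by ring
    have u3 : ∑ j, pd f j x * (2 * (graphV f x * pd (graphV f) j x) * ∑ i, pd (pd f i) i x)
        = 2 * (graphV f x * ∑ j, pd f j x * pd (graphV f) j x) * ∑ i, pd (pd f i) i x := by
      generalize ∑ i, pd (pd f i) i x = τ
      rw [Finset.mul_sum, Finset.mul_sum, Finset.sum_mul]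
      exact Finset.sum_congr rfl fun j _ => by ring
    have u4 : ∑ i, ∑ k, ((∑ j, pd (pd f i) j x * pd f j x) * pd f k x * pd (pd f k) i x
          + pd f i x * (∑ j, pd (pd f k) j x * pd f j x) * pd (pd f k) i x
          + pd f i x * pd f k x * ∑ j, pd f j x * pd (pd (pd f k) i) j x)
        = ∑ i, ∑ k, ∑ j, pd f j x * (pd (pd f i) j x * pd f k x * pd (pd f k) i x)
          + ∑ i, ∑ k, ∑ j, pd f j x * (pd f i x * pd (pd f k) j x * pd (pd f k) i x)
          + ∑ i, ∑ k, ∑ j, pd f j x * (pd f i x * pd f k x * pd (pd (pd f k) i) j x) := by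
      rw [← Finset.sum_add_distrib, ← Finset.sum_add_distrib]
      refine Finset.sum_congr rfl fun i _ => ?_
      rw [← Finset.sum_add_distrib, ← Finset.sum_add_distrib]
      refine Finset.sum_congr rfl fun k _ => ?_
      rw [Finset.sum_mul, Finset.sum_mul, Finset.mul_sum, Finset.sum_mul, Finset.mul_sum,
        ← Finset.sum_add_distrib, ← Finset.sum_add_distrib, ← Finset.sum_add_distrib,
        ← Finset.sum_add_distrib]
      exact Finset.sum_congr rfl fun j _ => by ring
    rw [u1, u2, u3] at hsum
    rw [hsum, u4]
  exact algebra_core hn (fun i => pd f i x) (fun i j => pd (pd f i) j x)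
    (fun i j => ∑ k, pd f k x * pd (pd (pd f i) j) k x) S ψ (graphV f x) (meanCurv f x) _ _ hψ hV0 rfl
    hVS hAsym hE hQ hDq (by rw [← hHeq]; ring) hDH

end Spatial

section Time
variable {n : ℕ} {U : Set (En n)}

theorem time_scalar {α b q r ψ K H P Dq DH N : ℝ} (hα : 0 < α) (hq : 0 < q) (hqr : q ^ 2 = 1 + r)
    (hψ : 0 < ψ) (hK : 0 < K) (hP : K * H = P) (h1 : ψ * Dq = q * r)
    (h2 : DH ≤ H / ψ - q * H ^ 2 / N)
    (h3 : 0 ≤ 2 * (q * (α * K) * DH + P * Dq) * (ψ * ψ)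
      + (1 + r) * ((-b - q * P) * ψ + ψ * (-b - q * P))) :
    q * b + α * ψ * q * (P * H) / N ≤ (α - 1) * P := by
  have h4 : ψ * DH ≤ H - ψ * (q * H ^ 2 / N) := by
    have := mul_le_mul_of_nonneg_left h2 hψ.le
    rwa [mul_sub, mul_div_cancel₀ _ hψ.ne'] at this
  have h5 : 0 ≤ q * (α * K) * (ψ * DH) + P * (ψ * Dq) - q ^ 2 * (b + q * P) := by
    have : 0 ≤ (2 * ψ) * (q * (α * K) * (ψ * DH) + P * (ψ * Dq) - q ^ 2 * (b + q * P)) := by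
      rw [hqr]
      refine h3.trans_eq ?_
      ring
    exact nonneg_of_mul_nonneg_right this (by positivity)
  have h6 := mul_le_mul_of_nonneg_left h4 (by positivity : 0 ≤ q * (α * K))
  have h7 : 0 ≤ q * ((α - 1) * P - (q * b + α * ψ * q * (P * H) / N)) := by
    have e : q * ((α - 1) * P - (q * b + α * ψ * q * (P * H) / N))
        = q * (α * K) * (H - ψ * (q * H ^ 2 / N)) + P * (q * r) - q ^ 2 * (b + q * P) := by
      rw [← hP]
      linear_combination q * (K * H) * hqr
    rw [e, ← h1]
    linarith
  have := nonneg_of_mul_nonneg_right h7 hq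
  linarith

theorem time_core (hn : 1 ≤ n) {α a b T : ℝ} (hα : 0 < α)
    (hU : IsOpen U) (u : En n → ℝ → ℝ)
    (hsm : ContDiffOn ℝ (⊤ : ℕ∞) (fun p : En n × ℝ => u p.1 p.2) (U ×ˢ Set.Icc 0 T))
    (hflow : ∀ x ∈ U, ∀ t ∈ Set.Icc (0:ℝ) T, u x t < a + 1 →
      0 < meanCurv (fun y => u y t) x ∧
      deriv (u x) t = graphV (fun y => u y t) x * meanCurv (fun y => u y t) x ^ α)
    {x : En n} (hx : x ∈ U) {t : ℝ} (ht : t ∈ Ioo 0 T) (hua : u x t < a + 1)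
    (hψ : 0 < a - b * t - u x t)
    (hmax : IsLocalMax (fun y => (1 + gradNormSq (fun z => u z t) y)
      * ((a - b * t - u y t) * (a - b * t - u y t))) x)
    {s₀ : ℝ} (hs₀ : s₀ < t)
    (hleft : ∀ s, s₀ < s → s < t →
      (1 + gradNormSq (fun z => u z s) x) * ((a - b * s - u x s) * (a - b * s - u x s)) ≤
      (1 + gradNormSq (fun z => u z t) x) * ((a - b * t - u x t) * (a - b * t - u x t))) :
    graphV (fun z => u z t) x * b + α * (a - b * t - u x t) * graphV (fun z => u z t) x
        * (meanCurv (fun z => u z t) x ^ α * meanCurv (fun z => u z t) x) / n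
      ≤ (α - 1) * meanCurv (fun z => u z t) x ^ α := by
  have htI : t ∈ Icc 0 T := ⟨ht.1.le, ht.2.le⟩
  set F : En n × ℝ → ℝ := fun p => u p.1 p.2 with hF
  set f : En n → ℝ := fun z => u z t with hf_def
  have hO : IsOpen (U ×ˢ Ioo (0:ℝ) T) := hU.prod isOpen_Ioo
  have hFO : ContDiffOn ℝ (⊤ : ℕ∞) F (U ×ˢ Ioo (0:ℝ) T) :=
    hsm.mono (Set.prod_mono_right Ioo_subset_Icc_self)
  have hFat : ∀ z ∈ U ×ˢ Ioo (0:ℝ) T, ContDiffAt ℝ (⊤ : ℕ∞) F z := fun z hz =>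
    hFO.contDiffAt (hO.mem_nhds hz)
  have hFd : ∀ z ∈ U ×ˢ Ioo (0:ℝ) T, DifferentiableAt ℝ F z := fun z hz =>
    (hFat z hz).differentiableAt (by simp)
  have hf : ContDiffOn ℝ (⊤ : ℕ∞) f U := by
    refine ContDiffOn.comp (g := F) (f := fun y : En n => (y, t)) hFO
      (contDiff_id.prodMk contDiff_const).contDiffOn ?_
    intro y hy
    exact ⟨hy, ht⟩
  -- partial derivatives in terms of the full derivative
  have hpd : ∀ y ∈ U, ∀ s ∈ Ioo (0:ℝ) T, ∀ k, pd (fun z => u z s) k y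
      = fderiv ℝ F (y, s) (EuclideanSpace.single k 1, 0) := by
    intro y hy s hs k
    have h1 : HasFDerivAt (fun z : En n => (z, s)) (ContinuousLinearMap.inl ℝ (En n) ℝ) y :=
      hasFDerivAt_prodMk_left y s
    have h2 := (hFd (y, s) ⟨hy, hs⟩).hasFDerivAt.comp y h1
    have h3 : fderiv ℝ (fun z => u z s) y
      = (fderiv ℝ F (y, s)).comp (ContinuousLinearMap.inl ℝ (En n) ℝ) := h2.fderiv
    unfold pd
    rw [h3]
    simp
  have hdt : ∀ y ∈ U, ∀ s ∈ Ioo (0:ℝ) T, HasDerivAt (u y) (fderiv ℝ F (y, s) (0, 1)) s := by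
    intro y hy s hs
    have h1 : HasDerivAt (fun r : ℝ => (y, r)) ((0 : En n), (1 : ℝ)) s :=
      (hasDerivAt_const s y).prodMk (hasDerivAt_id s)
    exact (hFd (y, s) ⟨hy, hs⟩).hasFDerivAt.comp_hasDerivAt s h1
  have hmix : ∀ k, HasDerivAt (fun s => pd (fun z => u z s) k x)
      (pd (fun y => deriv (u y) t) k x) t := by
    intro k
    have hz : (x, t) ∈ U ×ˢ Ioo (0:ℝ) T := ⟨hx, ht⟩
    have dd : ∀ v : En n × ℝ, DifferentiableAt ℝ (fun z => fderiv ℝ F z v) (x, t) := by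
      intro v
      have h1 : ContDiffAt ℝ 1 (fderiv ℝ F) (x, t) := (hFat _ hz).fderiv_right (m := 1)
        (WithTop.coe_le_coe.2 (le_top : ((1 + 1 : ℕ∞)) ≤ ⊤))
      exact (h1.differentiableAt (by norm_num)).clm_apply (differentiableAt_const v)
    have e1 : pd (fun y => deriv (u y) t) k x
        = fderiv ℝ (fun z => fderiv ℝ F z (0, 1)) (x, t) (EuclideanSpace.single k 1, 0) := by
      have h1 : HasFDerivAt (fun z : En n => (z, t)) (ContinuousLinearMap.inl ℝ (En n) ℝ) x :=
        hasFDerivAt_prodMk_left x t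
      have h2 := (dd (0, 1)).hasFDerivAt.comp x h1
      rw [pd_congr hU hx (fun y hy => (hdt y hy t ht).deriv) k]
      have h3 : fderiv ℝ (fun y => fderiv ℝ F (y, t) (0, 1)) x = _ := h2.fderiv
      unfold pd
      rw [h3]
      simp
    rw [e1, fderiv_fderiv_symm (hFat _ hz)]
    have h1 : HasDerivAt (fun r : ℝ => (x, r)) ((0 : En n), (1 : ℝ)) t :=
      (hasDerivAt_const t x).prodMk (hasDerivAt_id t)
    have h2 := (dd (EuclideanSpace.single k 1, 0)).hasFDerivAt.comp_hasDerivAt t h1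
    refine h2.congr_of_eventuallyEq ?_
    filter_upwards [isOpen_Ioo.mem_nhds ht] with s hs using hpd x hx s hs k
  obtain ⟨hHpos, hut⟩ := hflow x hx t htI hua
  change 0 < meanCurv f x at hHpos
  -- spatial derivative of the speed
  have hspeed : ∀ k, pd (fun y => deriv (u y) t) k x
      = graphV f x * (α * meanCurv f x ^ (α - 1) * pd (meanCurv f) k x)
        + meanCurv f x ^ α * pd (graphV f) k x := by
    intro k
    have hWo : IsOpen {y | y ∈ U ∧ f y < a + 1} := by
      have := hf.continuousOn.isOpen_inter_preimage hU (isOpen_Iio (a := a + 1))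
      exact this
    rw [pd_congr hWo (x := x) ⟨hx, hua⟩ (fun y hy => (hflow y hy.1 t htI hy.2).2) k]
    have dV := sm_diff hU (sm_graphV hU hf) hx
    have dH := sm_diff hU (sm_meanCurv hU hf) hx
    have hr : HasFDerivAt (fun y => meanCurv f y ^ α) _ x :=
      dH.hasFDerivAt.rpow_const (p := α) (Or.inl hHpos.ne')
    have := pd_mul dV hr.differentiableAt k
    rw [this]
    congr 2
    unfold pd
    rw [hr.fderiv]
    simp
  have hdu : HasDerivAt (u x) (graphV f x * meanCurv f x ^ α) t := by
    have := hdt x hx t ht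
    rwa [← this.deriv, hut] at this
  obtain ⟨hs1, hs2⟩ := spatial_core hn hU hf hx (a - b * t) hψ hmax
  have hdψ : HasDerivAt (fun s => a - b * s - u x s) (- b - graphV f x * meanCurv f x ^ α) t := by
    have := ((((hasDerivAt_id t).const_mul b).const_sub a)).fun_sub hdu
    simpa using this
  have hdS : HasDerivAt (fun s => 1 + gradNormSq (fun z => u z s) x)
      (∑ k, 2 * (pd f k x * pd (fun y => deriv (u y) t) k x)) t := by
    unfold gradNormSq
    refine HasDerivAt.const_add 1 (HasDerivAt.fun_sum fun k _ => ?_)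
    have := (hmix k).pow 2
    refine this.congr_deriv ?_
    simp only [hf_def]
    ring
  have hdG := deriv_nonneg_of_left_max hs₀ (hdS.fun_mul (hdψ.fun_mul hdψ)) hleft
  have hsum : ∑ k, 2 * (pd f k x * pd (fun y => deriv (u y) t) k x)
      = 2 * (graphV f x * (α * meanCurv f x ^ (α - 1)) * ∑ k, pd f k x * pd (meanCurv f) k x
        + meanCurv f x ^ α * ∑ k, pd f k x * pd (graphV f) k x) := by
    rw [Finset.mul_sum, Finset.mul_sum, ← Finset.sum_add_distrib, Finset.mul_sum]
    refine Finset.sum_congr rfl fun k _ => ?_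
    rw [hspeed]; ring
  rw [hsum] at hdG
  have hq := graphV_pos f x
  have hqS := graphV_sq f x
  have hpow : meanCurv f x ^ (α - 1) * meanCurv f x = meanCurv f x ^ α := by
    rw [← Real.rpow_add_one hHpos.ne']; simp
  have hK : 0 < meanCurv f x ^ (α - 1) := Real.rpow_pos_of_pos hHpos _
  exact time_scalar hα hq hqS hψ hK hpow hs1 hs2 hdG

end Time

section Main
variable {n : ℕ} {U : Set (En n)}

theorem continuousOn_gradNormSq {T : ℝ} (hT : 0 < T) (hU : IsOpen U) (u : En n → ℝ → ℝ)
    (hsm : ContDiffOn ℝ (⊤ : ℕ∞) (fun p : En n × ℝ => u p.1 p.2) (U ×ˢ Set.Icc 0 T)) :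
    ContinuousOn (fun p : En n × ℝ => gradNormSq (fun y => u y p.2) p.1) (U ×ˢ Set.Icc 0 T) := by
  have hud : UniqueDiffOn ℝ (U ×ˢ Set.Icc (0:ℝ) T) := hU.uniqueDiffOn.prod (uniqueDiffOn_Icc hT)
  have hc := hsm.continuousOn_fderivWithin hud (by simp)
  have hpd : ∀ k, ∀ p ∈ U ×ˢ Set.Icc (0:ℝ) T, pd (fun y => u y p.2) k p.1
      = fderivWithin ℝ (fun p : En n × ℝ => u p.1 p.2) (U ×ˢ Set.Icc 0 T) p
        (EuclideanSpace.single k 1, 0) := by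
    rintro k ⟨x, t⟩ hp
    have hd := (hsm.differentiableOn (by simp) _ hp).hasFDerivWithinAt
    have h1 : HasFDerivWithinAt (fun z : En n => (z, t)) (ContinuousLinearMap.inl ℝ (En n) ℝ) U x :=
      (hasFDerivAt_prodMk_left x t).hasFDerivWithinAt
    have hmap : MapsTo (fun z : En n => (z, t)) U (U ×ˢ Icc (0:ℝ) T) := fun y hy => ⟨hy, hp.2⟩
    have h2 := (hd.comp x h1 hmap).hasFDerivAt (hU.mem_nhds hp.1)
    have h3 : fderiv ℝ (fun y => u y t) x = _ := h2.fderiv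
    unfold pd
    simp only
    rw [h3]
    simp
  unfold gradNormSq
  refine continuousOn_finsetSum _ fun k _ => ContinuousOn.pow ?_ 2
  exact (hc.clm_apply continuousOn_const).congr (hpd k)

theorem mono_core {α a T : ℝ} (u : En n → ℝ → ℝ)
    (hsm : ContDiffOn ℝ (⊤ : ℕ∞) (fun p : En n × ℝ => u p.1 p.2) (U ×ˢ Set.Icc 0 T))
    (hflow : ∀ x ∈ U, ∀ t ∈ Set.Icc (0:ℝ) T, u x t < a + 1 →
      0 < meanCurv (fun y => u y t) x ∧
      deriv (u x) t = graphV (fun y => u y t) x * meanCurv (fun y => u y t) x ^ α)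
    {x : En n} (hx : x ∈ U) {t : ℝ} (ht : t ∈ Icc 0 T) (hua : u x t ≤ a) : u x 0 ≤ a := by
  have hc : ContinuousOn (u x) (Icc 0 t) := by
    refine ContinuousOn.comp (g := fun p : En n × ℝ => u p.1 p.2) (f := fun s : ℝ => (x, s))
      hsm.continuousOn (by fun_prop) ?_
    intro s hs
    exact ⟨hx, hs.1, hs.2.trans ht.2⟩
  obtain ⟨s, hs, hmin⟩ := isCompact_Icc.exists_isMinOn ⟨t, ht.1, le_rfl⟩ hc
  have hle : u x s ≤ u x t := hmin ⟨ht.1, le_rfl⟩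
  rcases hs.1.eq_or_lt with h0 | h0
  · rw [h0]; linarith
  · exfalso
    obtain ⟨hH, hd⟩ := hflow x hx s ⟨hs.1, hs.2.trans ht.2⟩ (by linarith)
    have hpos : 0 < deriv (u x) s := by
      rw [hd]; exact mul_pos (graphV_pos _ _) (Real.rpow_pos_of_pos hH _)
    have hda : DifferentiableAt ℝ (u x) s := differentiableAt_of_deriv_ne_zero hpos.ne'
    have := deriv_nonneg_of_left_max h0 hda.hasDerivAt.neg (fun r h1 h2 => by
      have : u x s ≤ u x r := hmin ⟨h1.le, h2.le.trans hs.2⟩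
      simpa using this)
    linarith

theorem final_scalar {α a b c q ψ H : ℝ} (hn : 1 ≤ n) (hα : 0 < α) (ha : 0 < a) (hb : 0 ≤ b)
    (hc : 0 < c) (hq : 0 < q) (hψ : 0 < ψ) (hψa : ψ ≤ a) (hH : 0 < H) (hcq : c * (q * ψ) = 1)
    (hcase : α ≤ 1 ∨ (1 < α ∧ c < α / (n * (α - 1)) ∧ c ≤ b / (a * (α - 1))))
    (h : q * b + α * ψ * q * (H ^ α * H) / n ≤ (α - 1) * H ^ α) : False := by
  have hN : (0:ℝ) < n := by exact_mod_cast hn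
  have hP : 0 < H ^ α := Real.rpow_pos_of_pos hH _
  have hpos : 0 < α * ψ * q * (H ^ α * H) / n := by positivity
  have hqb : 0 ≤ q * b := by positivity
  rcases hcase with h1 | ⟨h1, h2, h3⟩
  · nlinarith
  · have hα1 : 0 < α - 1 := by linarith
    rw [lt_div_iff₀ (by positivity)] at h2
    rw [le_div_iff₀ (by positivity)] at h3
    rcases le_or_gt 1 H with hH1 | hH1
    · have h4 : (α - 1) * H ^ α < α * ψ * q * (H ^ α * H) / n := by
        rw [lt_div_iff₀ hN]
        have e : (α - 1) * H ^ α * n = (c * (n * (α - 1))) * (q * ψ) * H ^ α := by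
          linear_combination (-(α - 1) * H ^ α * n) * hcq
        rw [e]
        calc (c * (n * (α - 1))) * (q * ψ) * H ^ α < α * (q * ψ) * H ^ α := by gcongr
          _ = α * ψ * q * (H ^ α * 1) := by ring
          _ ≤ α * ψ * q * (H ^ α * H) := by gcongr
      linarith
    · have hP1 : H ^ α ≤ 1 := Real.rpow_le_one hH.le hH1.le hα.le
      have h4 : α - 1 ≤ q * b := by
        calc α - 1 = (α - 1) * (c * (q * ψ)) := by rw [hcq, mul_one]
          _ ≤ (α - 1) * (c * (q * a)) := by gcongr
          _ = q * (c * (a * (α - 1))) := by ring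
          _ ≤ q * b := by gcongr
      nlinarith

theorem bound_core (hn : 1 ≤ n) {α a b T c : ℝ}
    (hα : 0 < α) (ha : 0 < a) (hb : 0 ≤ b) (hT : 0 < T) (hc : 0 < c)
    (hU : IsOpen U) (u : En n → ℝ → ℝ)
    (hsm : ContDiffOn ℝ (⊤ : ℕ∞) (fun p : En n × ℝ => u p.1 p.2) (U ×ˢ Set.Icc 0 T))
    (hnn : ∀ x ∈ U, ∀ t ∈ Set.Icc (0:ℝ) T, 0 ≤ u x t)
    (hcpt : ∀ t ∈ Set.Icc (0:ℝ) T, IsCompact {x ∈ U | u x t ≤ a})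
    (hflow : ∀ x ∈ U, ∀ t ∈ Set.Icc (0:ℝ) T, u x t < a + 1 →
      0 < meanCurv (fun y => u y t) x ∧
      deriv (u x) t = graphV (fun y => u y t) x * meanCurv (fun y => u y t) x ^ α)
    (hcase : α ≤ 1 ∨ (1 < α ∧ c < α / (n * (α - 1)) ∧ c ≤ b / (a * (α - 1))))
    (hinit : ∀ y ∈ U, 0 < a - b * 0 - u y 0 → (1 + gradNormSq (fun z => u z 0) y)
      * ((a - b * 0 - u y 0) * (a - b * 0 - u y 0)) < (c * c)⁻¹) :
    ∀ x ∈ U, ∀ t ∈ Set.Icc (0:ℝ) T, 0 < a - b * t - u x t → (1 + gradNormSq (fun z => u z t) x)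
      * ((a - b * t - u x t) * (a - b * t - u x t)) ≤ (c * c)⁻¹ := by
  set Ψ : En n × ℝ → ℝ := fun p => a - b * p.2 - u p.1 p.2 with hΨ
  set G : En n × ℝ → ℝ := fun p => (1 + gradNormSq (fun z => u z p.2) p.1) * (Ψ p * Ψ p) with hG
  have hm : 0 < (c * c)⁻¹ := by positivity
  set m := (c * c)⁻¹ with hmdef
  have cΨ : ContinuousOn Ψ (U ×ˢ Icc 0 T) := by
    refine ContinuousOn.sub (by fun_prop) hsm.continuousOn
  have cG : ContinuousOn G (U ×ˢ Icc 0 T) :=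
    (continuousOn_const.add (continuousOn_gradNormSq hT hU u hsm)).mul (cΨ.mul cΨ)
  set K : Set (En n) := {x ∈ U | u x 0 ≤ a} with hK
  have hKU : K ⊆ U := fun x hx => hx.1
  have hKc : IsCompact (K ×ˢ Icc (0:ℝ) T) := (hcpt 0 ⟨le_rfl, hT.le⟩).prod isCompact_Icc
  have hKsub : K ×ˢ Icc (0:ℝ) T ⊆ U ×ˢ Icc (0:ℝ) T := Set.prod_mono_left hKU
  have hmemK : ∀ p ∈ U ×ˢ Icc (0:ℝ) T, 0 ≤ Ψ p → p.1 ∈ K := by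
    rintro ⟨x, t⟩ ⟨hx, ht⟩ h
    refine ⟨hx, mono_core u hsm hflow hx ht ?_⟩
    have : 0 ≤ b * t := mul_nonneg hb ht.1
    simp only [hΨ] at h
    linarith
  -- no bad point before time T
  have hgood : ∀ p ∈ U ×ˢ Icc (0:ℝ) T, p.2 < T → 0 ≤ Ψ p → G p < m := by
    by_contra! hbad
    obtain ⟨p₁, hp₁, hp₁T, hp₁Ψ, hp₁G⟩ := hbad
    set Z : Set (En n × ℝ) := {p | p ∈ K ×ˢ Icc (0:ℝ) T ∧ (Ψ p, G p) ∈ Ici (0:ℝ) ×ˢ Ici m} with hZ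
    have hZc : IsCompact Z := by
      have hcl : IsClosed ((K ×ˢ Icc (0:ℝ) T) ∩ (fun p => (Ψ p, G p)) ⁻¹' (Ici (0:ℝ) ×ˢ Ici m)) :=
        ((cΨ.mono hKsub).prodMk (cG.mono hKsub)).preimage_isClosed_of_isClosed hKc.isClosed
          (isClosed_Ici.prod isClosed_Ici)
      exact hKc.of_isClosed_subset hcl Set.inter_subset_left
    have hZne : Z.Nonempty := ⟨p₁, ⟨hmemK p₁ hp₁ hp₁Ψ, hp₁.2⟩, hp₁Ψ, hp₁G⟩
    obtain ⟨⟨x, t⟩, hp, hpmin⟩ := hZc.exists_isMinOn hZne (continuous_snd.continuousOn)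
    obtain ⟨⟨hxK, htI⟩, hΨ0, hGm⟩ := hp
    have hx : x ∈ U := hKU hxK
    change t ∈ Icc 0 T at htI
    change 0 ≤ Ψ (x, t) at hΨ0
    change m ≤ G (x, t) at hGm
    have htT : t < T := by
      have : t ≤ p₁.2 := hpmin ⟨⟨hmemK p₁ hp₁ hp₁Ψ, hp₁.2⟩, hp₁Ψ, hp₁G⟩
      linarith
    have hbefore : ∀ y ∈ U, ∀ s ∈ Icc (0:ℝ) T, s < t → 0 ≤ Ψ (y, s) → G (y, s) < m := by
      intro y hy s hs hst h0
      by_contra! hcon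
      have : t ≤ s := hpmin (show (y, s) ∈ Z from ⟨⟨hmemK (y, s) ⟨hy, hs⟩ h0, hs⟩, h0, hcon⟩)
      linarith
    have hΨpos : 0 < Ψ (x, t) := by
      rcases hΨ0.eq_or_lt with h | h
      · exfalso
        have : G (x, t) = 0 := by simp only [hG]; rw [← h]; ring
        linarith
      · exact h
    have ht0 : 0 < t := by
      rcases htI.1.eq_or_lt with h | h
      · exfalso
        subst h
        have := hinit x hx hΨpos
        exact absurd hGm (not_le.2 this)
      · exact h
    have hIoo : t ∈ Ioo 0 T := ⟨ht0, htT⟩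
    have hnh : U ×ˢ Icc (0:ℝ) T ∈ nhds (x, t) :=
      prod_mem_nhds (hU.mem_nhds hx) (Icc_mem_nhds ht0 htT)
    have hev : ∀ᶠ p in nhds (x, t), p ∈ U ×ˢ Icc (0:ℝ) T ∧ 0 < Ψ p :=
      (Filter.eventually_mem_set.2 hnh).and
        ((cΨ.continuousAt hnh).eventually (lt_mem_nhds hΨpos))
    rw [nhds_prod_eq] at hev
    obtain ⟨pa, hpa, pb, hpb, hab⟩ := Filter.eventually_prod_iff.1 hev
    -- an interval of times to the left
    obtain ⟨s₀, hs₀, hs₀b⟩ : ∃ s₀ < t, ∀ s, s₀ < s → s ≤ t → pb s := by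
      obtain ⟨l, hl, hl2⟩ := exists_Ioc_subset_of_mem_nhds hpb ⟨t - 1, by linarith⟩
      exact ⟨l, hl, fun s h1 h2 => hl2 ⟨h1, h2⟩⟩
    have hpt : pb t := hs₀b t hs₀ le_rfl
    have hlt : ∀ y, pa y → ∀ s, s₀ < s → s < t → G (y, s) < m := by
      intro y hy s h1 h2
      have := hab hy (hs₀b s h1 h2.le)
      exact hbefore y this.1.1 s this.1.2 h2 this.2.le
    have hle : ∀ y, pa y → G (y, t) ≤ m := by
      intro y hy
      have hyt := hab hy hpt
      have hcy : ContinuousAt (fun s : ℝ => G (y, s)) t := by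
        have h1 : ContinuousAt G (y, t) := cG.continuousAt
          (prod_mem_nhds (hU.mem_nhds hyt.1.1) (Icc_mem_nhds ht0 htT))
        exact ContinuousAt.comp (f := fun s : ℝ => (y, s)) h1 (by fun_prop)
      have hten : Filter.Tendsto (fun s : ℝ => G (y, s)) (nhdsWithin t (Iio t)) (nhds (G (y, t))) :=
        hcy.tendsto.mono_left nhdsWithin_le_nhds
      refine le_of_tendsto hten ?_
      filter_upwards [Ioo_mem_nhdsLT hs₀] with s hs
      exact (hlt y hy s hs.1 hs.2).le
    have hpx : pa x := hpa.self_of_nhds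
    have hGeq : G (x, t) = m := le_antisymm (hle x hpx) hGm
    have hmax : IsLocalMax (fun y => (1 + gradNormSq (fun z => u z t) y)
        * ((a - b * t - u y t) * (a - b * t - u y t))) x := by
      filter_upwards [hpa] with y hy
      exact (hle y hy).trans hGm
    have hbt : 0 ≤ b * t := mul_nonneg hb htI.1
    have hΨpos' : 0 < a - b * t - u x t := hΨpos
    have hua : u x t < a + 1 := by linarith
    have key := time_core hn hα hU u hsm hflow hx hIoo hua hΨpos hmax hs₀
      (fun s h1 h2 => ((hlt x hpx s h1 h2).le).trans hGm)
    have hq := graphV_pos (fun z => u z t) x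
    have hqS := graphV_sq (fun z => u z t) x
    have hcq : c * (graphV (fun z => u z t) x * (a - b * t - u x t)) = 1 := by
      have h1 : (c * (graphV (fun z => u z t) x * (a - b * t - u x t))) ^ 2 = 1 := by
        have h2 : (1 + gradNormSq (fun z => u z t) x)
          * ((a - b * t - u x t) * (a - b * t - u x t)) = (c * c)⁻¹ := hGeq
        rw [← hqS] at h2
        have h3 : c * c * (c * c)⁻¹ = 1 := mul_inv_cancel₀ (by positivity)
        rw [← h2] at h3
        linear_combination h3
      have h2 : 0 < c * (graphV (fun z => u z t) x * (a - b * t - u x t)) := by positivity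
      nlinarith
    exact final_scalar hn hα ha hb hc hq hΨpos' (by linarith [hnn x hx t htI])
      (hflow x hx t htI hua).1 hcq hcase key
  intro x hx t ht hpos
  rcases ht.2.lt_or_eq with h | h
  · exact (hgood (x, t) ⟨hx, ht⟩ h hpos.le).le
  · subst h
    have cx : ∀ F : En n × ℝ → ℝ, ContinuousOn F (U ×ˢ Icc 0 t) →
        Filter.Tendsto (fun s : ℝ => F (x, s)) (nhdsWithin t (Iio t)) (nhds (F (x, t))) := by
      intro F hF
      have h1 : ContinuousWithinAt (fun s : ℝ => F (x, s)) (Icc 0 t) t :=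
        (ContinuousOn.comp (f := fun s : ℝ => (x, s)) hF (by fun_prop)
          (fun s hs => ⟨hx, hs⟩)) t ht
      have h2 : nhdsWithin t (Iio t) ≤ nhdsWithin t (Icc 0 t) :=
        nhdsWithin_le_of_mem (Filter.mem_of_superset (Ioo_mem_nhdsLT hT) Ioo_subset_Icc_self)
      exact h1.tendsto.mono_left h2
    refine le_of_tendsto (cx G cG) ?_
    filter_upwards [Ioo_mem_nhdsLT hT, (cx Ψ cΨ).eventually (lt_mem_nhds hpos)] with s hs h0
    exact (hgood (x, s) ⟨hx, hs.1.le, hs.2.le⟩ hs.2 (le_of_lt h0)).le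

end Main


/-- Localized gradient bound for the graphical `H^α`-flow. -/
theorem localized_gradient_bound (n : ℕ) (hn : 1 ≤ n) (α a b T : ℝ)
    (hα : 0 < α) (ha : 0 < a) (hb : 0 ≤ b) (hT : 0 < T)
    (U : Set (En n)) (hU : IsOpen U) (u : En n → ℝ → ℝ)
    (hsm : ContDiffOn ℝ (⊤ : ℕ∞) (fun p : En n × ℝ => u p.1 p.2) (U ×ˢ Set.Icc 0 T))
    (hnn : ∀ x ∈ U, ∀ t ∈ Set.Icc (0:ℝ) T, 0 ≤ u x t)
    (hcpt : ∀ t ∈ Set.Icc (0:ℝ) T, IsCompact {x ∈ U | u x t ≤ a})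
    (hflow : ∀ x ∈ U, ∀ t ∈ Set.Icc (0:ℝ) T, u x t < a + 1 →
      0 < meanCurv (fun y => u y t) x ∧
      deriv (u x) t = graphV (fun y => u y t) x * meanCurv (fun y => u y t) x ^ α) :
    ∀ x ∈ U, ∀ t ∈ Set.Icc (0:ℝ) T, 0 < psiF a b u x t →
      (α ≤ 1 →
        sInf ((fun y => wF u y 0 / psiF a b u y 0) '' {y ∈ U | 0 < psiF a b u y 0}) ≤
          wF u x t / psiF a b u x t) ∧
      (1 < α →
        min (sInf ((fun y => wF u y 0 / psiF a b u y 0) '' {y ∈ U | 0 < psiF a b u y 0}))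
            (min (α / (n * (α - 1))) (b / (a * (α - 1)))) ≤
          wF u x t / psiF a b u x t) := by
  intro x hx t ht hpos
  have hw : ∀ y s, 0 < wF u y s := fun y s => by
    have := gradNormSq_nonneg (fun z => u z s) y
    unfold wF; positivity
  have hratio0 : 0 ≤ wF u x t / psiF a b u x t := (div_pos (hw x t) hpos).le
  have hpsi : ∀ y s, 0 < psiF a b u y s → psiF a b u y s = a - b * s - u y s := by
    intro y s h
    unfold psiF at h ⊢
    rcases le_total (a - b * s - u y s) 0 with h' | h'
    · rw [max_eq_right h'] at h; exact absurd h (lt_irrefl _)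
    · exact max_eq_left h'
  -- the ratio controls the product function
  have hsq : ∀ y s, (wF u y s)⁻¹ ^ 2 = 1 + gradNormSq (fun z => u z s) y := by
    intro y s
    have := graphV_sq (fun z => u z s) y
    unfold graphV at this
    unfold wF
    rw [one_div, inv_inv, this]
  set I := sInf ((fun y => wF u y 0 / psiF a b u y 0) '' {y ∈ U | 0 < psiF a b u y 0}) with hI
  have hIle : ∀ y ∈ U, 0 < psiF a b u y 0 → I ≤ wF u y 0 / psiF a b u y 0 := by
    intro y hy h
    refine csInf_le ⟨0, ?_⟩ ⟨y, ⟨hy, h⟩, rfl⟩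
    rintro _ ⟨z, hz, rfl⟩
    exact (div_pos (hw z 0) hz.2).le
  have main : ∀ c, 0 < c → c < I →
      (α ≤ 1 ∨ (1 < α ∧ c < α / (n * (α - 1)) ∧ c ≤ b / (a * (α - 1)))) →
      c ≤ wF u x t / psiF a b u x t := by
    intro c hc hcI hcase
    have hb1 := bound_core hn hα ha hb hT hc hU u hsm hnn hcpt hflow hcase (by
      intro y hy h
      have hp : psiF a b u y 0 = a - b * 0 - u y 0 := max_eq_left h.le
      have h1 := hcI.trans_le (hIle y hy (by rw [hp]; exact h))
      rw [hp, lt_div_iff₀ h] at h1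
      rw [← hsq, lt_inv_comm₀ (by have := hw y 0; positivity) (by positivity), mul_inv, mul_inv, inv_pow,
        inv_inv, ← mul_inv, ← div_eq_mul_inv, lt_div_iff₀ (by positivity)]
      have hwy := hw y 0
      have : 0 < c * (a - b * 0 - u y 0) := by positivity
      nlinarith)
    have hp := hpsi x t hpos
    rw [hp] at hpos ⊢
    have h1 := hb1 x hx t ht hpos
    rw [← hsq, le_inv_comm₀ (by have := hw x t; positivity) (by positivity), mul_inv, mul_inv, inv_pow,
        inv_inv, ← mul_inv, ← div_eq_mul_inv, le_div_iff₀ (by positivity)] at h1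
    rw [le_div_iff₀ hpos]
    have hwx := hw x t
    refine le_of_sq_le_sq ?_ hwx.le
    nlinarith
  constructor
  · intro hα1
    refine le_of_forall_lt_imp_le_of_dense fun c hc => ?_
    rcases le_or_gt c 0 with h0 | h0
    · exact h0.trans hratio0
    · exact main c h0 hc (Or.inl hα1)
  · intro hα1
    refine le_of_forall_lt_imp_le_of_dense fun c hc => ?_
    rcases le_or_gt c 0 with h0 | h0
    · exact h0.trans hratio0
    · rw [lt_min_iff, lt_min_iff] at hc
      exact main c h0 hc.1 (Or.inr ⟨hα1, hc.2.1, hc.2.2.le⟩)
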